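/- Let n ≥ 3, let N₁, …, N_n ∈ SL(2,ℂ), and fix distinct indices j, k ∈ {1,…,n}. Set a_s = tr(N_s) for each s, x_{kj} = tr(N_k·N_j), and for each i ∉ {j,k} set x_{ji} = tr(N_j·N_i), x_{ki} = tr(N_k·N_i), x_{kji} = tr(N_k·N_j·N_i). Assume x_{kj}² ≠ 4 and ψ(x_{kj}, a_k, a_j) ≠ 0, and fix r ∈ ℂ with r² = x_{kj}² − 4. Then there exists P ∈ SL(2,ℂ) such that P·N_s·P⁻¹ = M_s for all s = 1,…,n, where (M₁,…,M_n) is the normal-form tuple associated to the data (a_s), (x_{ji}), (x_{ki}), (x_{kji}), x_{kj} and the square root r. -/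

import Mathlib

open Matrix

/-- `ψ(s,t,u) = s² + t² + u² − stu − 4`. -/
noncomputable def psi (s t u : ℂ) : ℂ := s ^ 2 + t ^ 2 + u ^ 2 - s * t * u - 4

/-- The normal-form tuple `(M₁,…,Mₙ)` associated to the data
`(a_s)`, `(x_{ji})`, `(x_{ki})`, `(x_{kji})`, `x_{kj}` and a square root `r` of
`x_{kj}² − 4`, with `λ₊ = (x_{kj}+r)/2`, `λ₋ = (x_{kj}−r)/2`. -/
noncomputable def normalForm {n : ℕ} (j k : Fin n) (a xji xki xkji : Fin n → ℂ)
    (xkj r : ℂ) : Fin n → Matrix (Fin 2) (Fin 2) ℂ := fun s =>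
  let lp : ℂ := (xkj + r) / 2
  let lm : ℂ := (xkj - r) / 2
  if s = j then
    !![-(a k - lp * a j) / r, -psi xkj (a k) (a j) / r ^ 2;
       1, (a k - lm * a j) / r]
  else if s = k then
    !![-(a j - lp * a k) / r, lp * psi xkj (a k) (a j) / r ^ 2;
       -lm, (a j - lm * a k) / r]
  else
    let u11 := (xkji s - lm * a s) / r
    let u22 := -(xkji s - lp * a s) / r
    !![u11, (xki s - a k * u22 + lp * (xji s - a j * u11)) / r;
       r * (xki s - a k * u11 + lm * (xji s - a j * u22)) / psi xkj (a k) (a j), u22]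

section Conjugation

variable {P : Matrix (Fin 2) (Fin 2) ℂ}

lemma conj_mul_conj_of_det_eq_one (hP : P.det = 1) (X Y : Matrix (Fin 2) (Fin 2) ℂ) :
    P * X * P⁻¹ * (P * Y * P⁻¹) = P * (X * Y) * P⁻¹ := by
  have h : P⁻¹ * P = 1 := nonsing_inv_mul P (by simp [hP])
  calc P * X * P⁻¹ * (P * Y * P⁻¹) = P * X * (P⁻¹ * P) * Y * P⁻¹ := by simp only [mul_assoc]
    _ = P * (X * Y) * P⁻¹ := by rw [h, mul_one, mul_assoc P X Y]

lemma trace_conj_of_det_eq_one (hP : P.det = 1) (X : Matrix (Fin 2) (Fin 2) ℂ) :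
    (P * X * P⁻¹).trace = X.trace := by
  rw [trace_mul_comm, ← mul_assoc, nonsing_inv_mul P (by simp [hP]), one_mul]

lemma det_conj_of_det_eq_one (hP : P.det = 1) (X : Matrix (Fin 2) (Fin 2) ℂ) :
    (P * X * P⁻¹).det = X.det := by
  rw [det_mul, det_mul, det_nonsing_inv, hP]
  simp

end Conjugation

/-- A `2 × 2` matrix of determinant one with distinct eigenvalues `l`, `m` is diagonalizable, with
the eigenvalues in the prescribed order. -/
lemma exists_mul_eq_diagonal_mul (A : Matrix (Fin 2) (Fin 2) ℂ) {l m : ℂ}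
    (htr : l + m = A.trace) (hdet : l * m = A.det) (hlm : l ≠ m) :
    ∃ Q : Matrix (Fin 2) (Fin 2) ℂ, Q.det ≠ 0 ∧ Q * A = !![l, 0; 0, m] * Q := by
  have hsub : l - m ≠ 0 := sub_ne_zero.mpr hlm
  rw [trace_fin_two] at htr
  rw [det_fin_two] at hdet
  by_cases hc : A 1 0 = 0
  · by_cases hb : A 0 1 = 0
    · have hroot : (l - A 0 0) * (l - A 1 1) = 0 := by
        rw [hb] at hdet
        linear_combination l * htr - hdet
      rcases mul_eq_zero.mp hroot with h | h
      · refine ⟨1, by simp, ?_⟩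
        have hm : A 1 1 = m := by linear_combination h - htr
        ext x y
        fin_cases x <;> fin_cases y <;> simp [hb, hc, hm]
        linear_combination -h
      · refine ⟨!![0, 1; 1, 0], by simp [det_fin_two], ?_⟩
        ext x y
        fin_cases x <;> fin_cases y <;> simp [mul_apply, Fin.sum_univ_two, hb, hc]
        · linear_combination -h
        · linear_combination h - htr
    · refine ⟨!![l - A 1 1, A 0 1; m - A 1 1, A 0 1], ?_, ?_⟩
      · rw [det_fin_two_of]
        convert mul_ne_zero hb hsub using 1
        ring
      · ext x y
        fin_cases x <;> fin_cases y <;> simp [mul_apply, Fin.sum_univ_two]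
        · linear_combination hdet - l * htr
        · ring
        · linear_combination hdet - m * htr
        · ring
  · refine ⟨!![A 1 0, l - A 0 0; A 1 0, m - A 0 0], ?_, ?_⟩
    · rw [det_fin_two_of]
      convert mul_ne_zero hc (neg_ne_zero.mpr hsub) using 1
      ring
    · ext x y
      fin_cases x <;> fin_cases y <;> simp [mul_apply, Fin.sum_univ_two]
      · ring
      · linear_combination hdet - l * htr
      · ring
      · linear_combination hdet - m * htr

/-- An invertible complex matrix of size two can be rescaled to have determinant one. -/
lemma exists_smul_det_eq_one (Q : Matrix (Fin 2) (Fin 2) ℂ) (hQ : Q.det ≠ 0) :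
    ∃ c : ℂ, (c • Q).det = 1 := by
  obtain ⟨d, hd⟩ := IsAlgClosed.exists_pow_nat_eq Q.det (n := 2) two_pos
  refine ⟨d⁻¹, ?_⟩
  rw [det_smul, Fintype.card_fin, inv_pow, hd, inv_mul_cancel₀ hQ]

/-- If `K * J = diag(l, m)` with `det J = 1`, then `K = diag(l, m) * adj J`. -/
lemma eq_of_mul_eq_diagonal {K J : Matrix (Fin 2) (Fin 2) ℂ} {l m : ℂ} (hJ : J.det = 1)
    (hKJ : K * J = !![l, 0; 0, m]) :
    K = !![l * J 1 1, -(l * J 0 1); -(m * J 1 0), m * J 0 0] := by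
  have h : K = !![l, 0; 0, m] * J.adjugate := by
    rw [← hKJ, Matrix.mul_assoc, mul_adjugate, hJ, one_smul, Matrix.mul_one]
  rw [h, adjugate_fin_two]
  ext x y
  fin_cases x <;> fin_cases y <;> simp [mul_apply, Fin.sum_univ_two]

lemma psi_eq_of_mul_eq_diagonal {K J : Matrix (Fin 2) (Fin 2) ℂ} {l m : ℂ} (hJ : J.det = 1)
    (hlm : l * m = 1) (hKJ : K * J = !![l, 0; 0, m]) :
    psi (K * J).trace K.trace J.trace = -((l - m) ^ 2 * (J 0 1 * J 1 0)) := by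
  have hK := eq_of_mul_eq_diagonal hJ hKJ
  rw [det_fin_two] at hJ
  rw [hKJ, hK]
  simp only [trace_fin_two_of, trace_fin_two J, psi]
  linear_combination (4 - (J 0 0 + J 1 1) ^ 2) * hlm - (l - m) ^ 2 * hJ

/-- A tuple with `M k * M j` diagonal and lower-left entry of `M j` equal to one is in normal
form. -/
lemma eq_normalForm {n : ℕ} {j k : Fin n} (M : Fin n → Matrix (Fin 2) (Fin 2) ℂ)
    {l m : ℂ} (hlm : l * m = 1) (hne : l - m ≠ 0) (hJ : (M j).det = 1)
    (hKJ : M k * M j = !![l, 0; 0, m]) (hone : M j 1 0 = 1)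
    (hpsi : psi (M k * M j).trace (M k).trace (M j).trace ≠ 0) (s : Fin n) :
    M s = normalForm j k (fun s => (M s).trace) (fun i => (M j * M i).trace)
      (fun i => (M k * M i).trace) (fun i => (M k * M j * M i).trace)
      (M k * M j).trace (l - m) s := by
  have hp := psi_eq_of_mul_eq_diagonal hJ hlm hKJ
  have hK := eq_of_mul_eq_diagonal hJ hKJ
  rw [hone, mul_one] at hp
  have hq : M j 0 1 ≠ 0 := by
    intro h
    simp [hp, h] at hpsi
  have hl : ((M k * M j).trace + (l - m)) / 2 = l := by
    rw [hKJ, trace_fin_two_of]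
    ring
  have hm : ((M k * M j).trace - (l - m)) / 2 = m := by
    rw [hKJ, trace_fin_two_of]
    ring
  have htK : (M k).trace = l * M j 1 1 + m * M j 0 0 := by
    rw [hK, trace_fin_two_of]
  simp only [normalForm, hl, hm, hp]
  rw [htK, trace_fin_two (M j)]
  split_ifs with hsj hsk
  · subst hsj
    ext x y
    fin_cases x <;> fin_cases y <;> simp [hone] <;> field_simp <;> ring
  · subst hsk
    nth_rw 1 [hK]
    ext x y
    fin_cases x <;> fin_cases y <;> simp [hone] <;> field_simp
    · linear_combination -(M j 0 0 + M j 1 1) * hlm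
    · linear_combination (M j 0 0 + M j 1 1) * hlm
  · have hu : ((M k * M j * M s).trace - m * (M s).trace) / (l - m) = M s 0 0 := by
      rw [hKJ, div_eq_iff hne]
      simp [trace_fin_two, vecMul, dotProduct, Fin.sum_univ_two]
      ring
    have hv : -((M k * M j * M s).trace - l * (M s).trace) / (l - m) = M s 1 1 := by
      rw [hKJ, div_eq_iff hne]
      simp [trace_fin_two, vecMul, dotProduct, Fin.sum_univ_two]
      ring
    have htKs : (M k * M s).trace = l * M j 1 1 * M s 0 0 - l * M j 0 1 * M s 1 0
        - m * M s 0 1 + m * M j 0 0 * M s 1 1 := by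
      rw [hK, hone]
      simp [trace_fin_two, vecMul, dotProduct, Fin.sum_univ_two]
      ring
    have htJs : (M j * M s).trace = M j 0 0 * M s 0 0 + M j 0 1 * M s 1 0
        + M s 0 1 + M j 1 1 * M s 1 1 := by
      simp [trace_fin_two, mul_apply, Fin.sum_univ_two, hone]
      ring
    rw [hu, hv, htKs, htJs]
    ext x y
    fin_cases x <;> fin_cases y <;> simp <;> field_simp <;> ring

/-- Any tuple `(N₁,…,Nₙ)` in `SL(2,ℂ)` with `x_{kj}² ≠ 4` and `ψ(x_{kj},a_k,a_j) ≠ 0`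
is conjugate in `SL(2,ℂ)` to the normal-form tuple built from its trace data. -/
theorem conjugate_to_normal_form (n : ℕ) (hn : 3 ≤ n)
    (N : Fin n → Matrix (Fin 2) (Fin 2) ℂ) (hdet : ∀ s, (N s).det = 1)
    (j k : Fin n) (hjk : j ≠ k)
    (h4 : (N k * N j).trace ^ 2 ≠ 4)
    (hpsi : psi ((N k * N j).trace) ((N k).trace) ((N j).trace) ≠ 0)
    (r : ℂ) (hr : r ^ 2 = (N k * N j).trace ^ 2 - 4) :
    ∃ P : Matrix (Fin 2) (Fin 2) ℂ, P.det = 1 ∧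
      ∀ s, P * N s * P⁻¹ =
        normalForm j k (fun s => (N s).trace) (fun i => (N j * N i).trace)
          (fun i => (N k * N i).trace) (fun i => (N k * N j * N i).trace)
          ((N k * N j).trace) r s := by
  have hr0 : r ≠ 0 := by
    rintro rfl
    exact h4 (by linear_combination -hr)
  obtain ⟨l, hl⟩ : ∃ l, l = ((N k * N j).trace + r) / 2 := ⟨_, rfl⟩
  obtain ⟨m, hm⟩ : ∃ m, m = ((N k * N j).trace - r) / 2 := ⟨_, rfl⟩
  have hsub : l - m = r := by
    rw [hl, hm]
    ring
  have hlm : l * m = 1 := by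
    rw [hl, hm]
    linear_combination -hr / 4
  have hne : l - m ≠ 0 := hsub ▸ hr0
  obtain ⟨Q, hQ, hQA⟩ := exists_mul_eq_diagonal_mul (N k * N j) (l := l) (m := m)
    (by rw [hl, hm]; ring) (by rw [det_mul, hdet, hdet, hlm, one_mul]) (sub_ne_zero.mp hne)
  obtain ⟨c, hc⟩ := exists_smul_det_eq_one Q hQ
  have hcA : c • Q * (N k * N j) = !![l, 0; 0, m] * (c • Q) := by
    rw [smul_mul_assoc, hQA, mul_smul_comm]
  generalize c • Q = Q at hc hcA
  set J := Q * N j * Q⁻¹ with hJ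
  have hJdet : J.det = 1 := by rw [hJ, det_conj_of_det_eq_one hc, hdet]
  have hKJ : Q * N k * Q⁻¹ * J = !![l, 0; 0, m] := by
    rw [hJ, conj_mul_conj_of_det_eq_one hc, hcA, mul_assoc, mul_nonsing_inv _ (by simp [hc]),
      mul_one]
  have hd : J 1 0 ≠ 0 := by
    intro h
    have := psi_eq_of_mul_eq_diagonal hJdet hlm hKJ
    rw [hJ, conj_mul_conj_of_det_eq_one hc, trace_conj_of_det_eq_one hc,
      trace_conj_of_det_eq_one hc, trace_conj_of_det_eq_one hc, ← hJ, h] at this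
    exact hpsi (by simpa using this)
  obtain ⟨t, ht⟩ := IsAlgClosed.exists_pow_nat_eq (J 1 0) (n := 2) two_pos
  have ht0 : t ≠ 0 := by
    rintro rfl
    exact hd (by simpa using ht.symm)
  have hEinv : (!![t, 0; 0, t⁻¹])⁻¹ = !![t⁻¹, 0; 0, t] := by
    refine inv_eq_right_inv ?_
    ext x y
    fin_cases x <;> fin_cases y <;> simp [ht0]
  have hP : (!![t, 0; 0, t⁻¹] * Q).det = 1 := by
    rw [det_mul, hc, det_fin_two_of]
    simp [ht0]
  have hconj (X : Matrix (Fin 2) (Fin 2) ℂ) :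
      !![t, 0; 0, t⁻¹] * Q * X * (!![t, 0; 0, t⁻¹] * Q)⁻¹ =
        !![t, 0; 0, t⁻¹] * (Q * X * Q⁻¹) * !![t⁻¹, 0; 0, t] := by
    rw [Matrix.mul_inv_rev, hEinv]
    simp only [mul_assoc]
  have hdiag : !![t, 0; 0, t⁻¹] * Q * (N k * N j) * (!![t, 0; 0, t⁻¹] * Q)⁻¹ =
      !![l, 0; 0, m] := by
    rw [hconj, ← conj_mul_conj_of_det_eq_one hc, hKJ]
    ext x y
    fin_cases x <;> fin_cases y <;> simp [mul_apply, Fin.sum_univ_two] <;> field_simp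
  have hone : (!![t, 0; 0, t⁻¹] * Q * N j * (!![t, 0; 0, t⁻¹] * Q)⁻¹) 1 0 = 1 := by
    rw [hconj, ← hJ]
    simp [mul_apply, vecMul, dotProduct, Fin.sum_univ_two, ← ht]
    field_simp
  refine ⟨!![t, 0; 0, t⁻¹] * Q, hP, fun s => ?_⟩
  generalize !![t, 0; 0, t⁻¹] * Q = P at hP hdiag hone
  have key := eq_normalForm (j := j) (k := k) (fun s => P * N s * P⁻¹) hlm hne
    (by rw [det_conj_of_det_eq_one hP, hdet])
    (by rw [conj_mul_conj_of_det_eq_one hP, hdiag]) hone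
    (by simpa only [conj_mul_conj_of_det_eq_one hP, trace_conj_of_det_eq_one hP] using hpsi) s
  simpa only [conj_mul_conj_of_det_eq_one hP, trace_conj_of_det_eq_one hP, hsub] using key
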